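/- Let K be a field of characteristic 0 and let m ≥ 1. The quotient ring R = K[x1,x2,x3,x4]/(x1², x2², x3², x4^{m+1}, x1x2, x1x3, x2x4^m, x3x4^m, x2x3 − x1x4) is a finite-dimensional K-vector space of dimension 4m + 2. -/

import Mathlib

open MvPolynomial

noncomputable def relIdeal (K : Type*) [Field K] (m : ℕ) :
    Ideal (MvPolynomial (Fin 4) K) :=
  Ideal.span {X 0 ^ 2, X 1 ^ 2, X 2 ^ 2, X 3 ^ (m + 1), X 0 * X 1, X 0 * X 2,
    X 1 * X 3 ^ m, X 2 * X 3 ^ m, X 1 * X 2 - X 0 * X 3}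

namespace FPA

/-- exponent vectors -/
noncomputable def ex (a b c d : ℕ) : Fin 4 →₀ ℕ := Finsupp.equivFunOnFinite.symm ![a, b, c, d]

theorem ex_le (a b c d a' b' c' d' : ℕ) :
    ex a b c d ≤ ex a' b' c' d' ↔ a ≤ a' ∧ b ≤ b' ∧ c ≤ c' ∧ d ≤ d' := by
  rw [Finsupp.le_def, Fin.forall_fin_succ, Fin.forall_fin_succ, Fin.forall_fin_succ,
    Fin.forall_fin_succ]
  simp [ex]

theorem ex_sub (a b c d a' b' c' d' : ℕ) :
    ex a b c d - ex a' b' c' d' = ex (a - a') (b - b') (c - c') (d - d') := by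
  ext i
  fin_cases i <;> simp [ex]

theorem ex_inj (a b c d a' b' c' d' : ℕ) :
    ex a b c d = ex a' b' c' d' ↔ a = a' ∧ b = b' ∧ c = c' ∧ d = d' := by
  rw [le_antisymm_iff, ex_le, ex_le]
  omega

theorem mon_eq (K : Type*) [Field K] (a b c d : ℕ) :
    (monomial (ex a b c d) 1 : MvPolynomial (Fin 4) K)
      = X 0 ^ a * X 1 ^ b * X 2 ^ c * X 3 ^ d := by
  rw [monomial_eq, Finsupp.prod_fintype _ _ (by simp)]
  simp [Fin.prod_univ_four, ex]

theorem exists_ex (s : Fin 4 →₀ ℕ) : s = ex (s 0) (s 1) (s 2) (s 3) := by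
  ext i
  fin_cases i <;> simp [ex]

abbrev Idx (m : ℕ) := (Fin (m + 1) ⊕ Fin (m + 1)) ⊕ (Fin m ⊕ Fin m)

/-- coordinate functionals -/
noncomputable def cf (K : Type*) [Field K] (m : ℕ) : Idx m → MvPolynomial (Fin 4) K →ₗ[K] K
  | .inl (.inl d) => lcoeff K (ex 0 0 0 d)
  | .inl (.inr d) => lcoeff K (ex 1 0 0 d) +
      if (d : ℕ) = 0 then 0 else lcoeff K (ex 0 1 1 (d - 1))
  | .inr (.inl d) => lcoeff K (ex 0 1 0 d)
  | .inr (.inr d) => lcoeff K (ex 0 0 1 d)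

theorem coeff_mul_mon (K : Type*) [Field K] (r : MvPolynomial (Fin 4) K)
    (a b c d a' b' c' d' : ℕ) :
    coeff (ex a b c d) (r * (X 0 ^ a' * X 1 ^ b' * X 2 ^ c' * X 3 ^ d')) =
      if a' ≤ a ∧ b' ≤ b ∧ c' ≤ c ∧ d' ≤ d then
        coeff (ex (a - a') (b - b') (c - c') (d - d')) r else 0 := by
  rw [← mon_eq, coeff_mul_monomial', ex_sub]
  simp only [ex_le, mul_one]

theorem cf_mul_mon (K : Type*) [Field K] (m : ℕ) (i : Idx m) (r : MvPolynomial (Fin 4) K)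
    (a b c d : ℕ) (h : 2 ≤ a ∨ 2 ≤ b ∨ 2 ≤ c ∨ m + 1 ≤ d ∨ (1 ≤ a ∧ 1 ≤ b) ∨ (1 ≤ a ∧ 1 ≤ c) ∨
      (1 ≤ b ∧ m ≤ d) ∨ (1 ≤ c ∧ m ≤ d)) :
    cf K m i (r * (X 0 ^ a * X 1 ^ b * X 2 ^ c * X 3 ^ d)) = 0 := by
  rcases i with (i | i) | (i | i)
  · have := i.2
    simp only [cf, lcoeff_apply, coeff_mul_mon]
    rw [if_neg (by omega)]
  · have := i.2
    simp only [cf, LinearMap.add_apply, lcoeff_apply, coeff_mul_mon]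
    rw [if_neg (by omega)]
    split_ifs with h1
    · simp
    · simp only [lcoeff_apply, coeff_mul_mon]
      rw [if_neg (by omega)]
      simp
  · have := i.2
    simp only [cf, lcoeff_apply, coeff_mul_mon]
    rw [if_neg (by omega)]
  · have := i.2
    simp only [cf, lcoeff_apply, coeff_mul_mon]
    rw [if_neg (by omega)]

theorem cf_mul_bin (K : Type*) [Field K] (m : ℕ) (i : Idx m) (r : MvPolynomial (Fin 4) K) :
    cf K m i (r * (X 1 * X 2 - X 0 * X 3)) = 0 := by
  have e : r * (X 1 * X 2 - X 0 * X 3) = r * (X 0 ^ 0 * X 1 ^ 1 * X 2 ^ 1 * X 3 ^ 0)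
      - r * (X 0 ^ 1 * X 1 ^ 0 * X 2 ^ 0 * X 3 ^ 1) := by ring
  rw [e, map_sub]
  rcases i with (i | i) | (i | i)
  · simp only [cf, lcoeff_apply, coeff_mul_mon]
    simp
  · simp only [cf, LinearMap.add_apply, lcoeff_apply, coeff_mul_mon]
    by_cases h1 : (i : ℕ) = 0
    · simp [h1]
    · have : 1 ≤ (i : ℕ) := by omega
      simp only [if_neg h1, lcoeff_apply, coeff_mul_mon]
      simp [this]
  · simp only [cf, lcoeff_apply, coeff_mul_mon]
    simp
  · simp only [cf, lcoeff_apply, coeff_mul_mon]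
    simp

theorem cf_mem (K : Type*) [Field K] (m : ℕ) (i : Idx m) (p : MvPolynomial (Fin 4) K)
    (hp : p ∈ relIdeal K m) : ∀ r, cf K m i (r * p) = 0 := by
  unfold relIdeal at hp
  induction hp using Submodule.span_induction with
  | mem x hx =>
    intro r
    simp only [Set.mem_insert_iff, Set.mem_singleton_iff] at hx
    rcases hx with h | h | h | h | h | h | h | h | h
    · simpa [h] using cf_mul_mon K m i r 2 0 0 0 (by omega)
    · simpa [h] using cf_mul_mon K m i r 0 2 0 0 (by omega)
    · simpa [h] using cf_mul_mon K m i r 0 0 2 0 (by omega)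
    · simpa [h] using cf_mul_mon K m i r 0 0 0 (m + 1) (by omega)
    · simpa [h] using cf_mul_mon K m i r 1 1 0 0 (by omega)
    · simpa [h] using cf_mul_mon K m i r 1 0 1 0 (by omega)
    · simpa [h] using cf_mul_mon K m i r 0 1 0 m (by omega)
    · simpa [h] using cf_mul_mon K m i r 0 0 1 m (by omega)
    · rw [h]
      exact cf_mul_bin K m i r
  | zero => simp
  | add x y _ _ hx hy => intro r; rw [mul_add, map_add, hx, hy, add_zero]
  | smul a x _ hx => intro r; rw [smul_eq_mul, ← mul_assoc]; exact hx _

noncomputable def L (K : Type*) [Field K] (m : ℕ) :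
    (MvPolynomial (Fin 4) K ⧸ relIdeal K m) →ₗ[K] (Idx m → K) :=
  Submodule.liftQ ((relIdeal K m).restrictScalars K) (LinearMap.pi (cf K m)) (by
    intro p hp
    rw [LinearMap.mem_ker]
    ext i
    simpa using cf_mem K m i p hp 1)

noncomputable def sec (m : ℕ) : Idx m → (Fin 4 →₀ ℕ)
  | .inl (.inl d) => ex 0 0 0 d
  | .inl (.inr d) => ex 1 0 0 d
  | .inr (.inl d) => ex 0 1 0 d
  | .inr (.inr d) => ex 0 0 1 d

noncomputable def v (K : Type*) [Field K] (m : ℕ) (i : Idx m) :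
    MvPolynomial (Fin 4) K ⧸ relIdeal K m :=
  Ideal.Quotient.mk (relIdeal K m) (monomial (sec m i) 1)

theorem L_v (K : Type*) [Field K] (m : ℕ) (i : Idx m) : L K m (v K m i) = Pi.single i 1 := by
  have : L K m (v K m i) = LinearMap.pi (cf K m) (monomial (sec m i) 1) := rfl
  rw [this]
  ext j
  rw [LinearMap.pi_apply, Pi.single_apply]
  rcases i with (i | i) | (i | i) <;> rcases j with (j | j) | (j | j) <;>
    simp only [cf, sec, LinearMap.add_apply, lcoeff_apply, coeff_monomial, ex_inj] <;>
    simp only [Sum.inl.injEq, Sum.inr.injEq, reduceCtorEq, Fin.ext_iff] <;>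
    split_ifs <;>
    first
      | (exfalso; clear this; omega)
      | (exfalso; tauto)
      | (simp [coeff_monomial, ex_inj]; done)

theorem li (K : Type*) [Field K] (m : ℕ) : LinearIndependent K (v K m) := by
  apply LinearIndependent.of_comp (L K m)
  have : (L K m) ∘ (v K m) = Pi.basisFun K (Idx m) := by
    ext1 i
    simp [L_v]
  rw [this]
  exact (Pi.basisFun K (Idx m)).linearIndependent

theorem mk_zero (K : Type*) [Field K] (m : ℕ) (a b c d : ℕ)
    (h : 2 ≤ a ∨ 2 ≤ b ∨ 2 ≤ c ∨ m + 1 ≤ d ∨ (1 ≤ a ∧ 1 ≤ b) ∨ (1 ≤ a ∧ 1 ≤ c) ∨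
      (1 ≤ b ∧ m ≤ d) ∨ (1 ≤ c ∧ m ≤ d)) :
    (X 0 ^ a * X 1 ^ b * X 2 ^ c * X 3 ^ d : MvPolynomial (Fin 4) K) ∈ relIdeal K m := by
  have key : ∀ a' b' c' d' : ℕ, a' ≤ a → b' ≤ b → c' ≤ c → d' ≤ d →
      (X 0 ^ a' * X 1 ^ b' * X 2 ^ c' * X 3 ^ d' : MvPolynomial (Fin 4) K) ∈ relIdeal K m →
      (X 0 ^ a * X 1 ^ b * X 2 ^ c * X 3 ^ d : MvPolynomial (Fin 4) K) ∈ relIdeal K m := by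
    intro a' b' c' d' h1 h2 h3 h4 hm
    refine Ideal.mem_of_dvd _ ?_ hm
    gcongr
  rcases h with h | h | h | h | h | h | h | h
  · exact key 2 0 0 0 (by omega) (by omega) (by omega) (by omega)
      (Ideal.subset_span (by simp))
  · exact key 0 2 0 0 (by omega) (by omega) (by omega) (by omega)
      (Ideal.subset_span (by simp))
  · exact key 0 0 2 0 (by omega) (by omega) (by omega) (by omega)
      (Ideal.subset_span (by simp))
  · exact key 0 0 0 (m + 1) (by omega) (by omega) (by omega) (by omega)
      (Ideal.subset_span (by simp))
  · exact key 1 1 0 0 (by omega) (by omega) (by omega) (by omega)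
      (Ideal.subset_span (by simp))
  · exact key 1 0 1 0 (by omega) (by omega) (by omega) (by omega)
      (Ideal.subset_span (by simp))
  · exact key 0 1 0 m (by omega) (by omega) (by omega) (by omega)
      (Ideal.subset_span (by simp))
  · exact key 0 0 1 m (by omega) (by omega) (by omega) (by omega)
      (Ideal.subset_span (by simp))

theorem mk_bin (K : Type*) [Field K] (m : ℕ) (d : ℕ) :
    Ideal.Quotient.mk (relIdeal K m) (monomial (ex 0 1 1 d) 1) =
      Ideal.Quotient.mk (relIdeal K m) (monomial (ex 1 0 0 (d + 1)) 1) := by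
  rw [Ideal.Quotient.eq, mon_eq, mon_eq]
  have : (X 1 * X 2 - X 0 * X 3 : MvPolynomial (Fin 4) K) ∈ relIdeal K m :=
    Ideal.subset_span (by simp)
  have h2 := (relIdeal K m).mul_mem_left (X 3 ^ d) this
  convert h2 using 1
  ring

theorem mon_mem (K : Type*) [Field K] (m : ℕ) (a b c d : ℕ) :
    Ideal.Quotient.mk (relIdeal K m) (monomial (ex a b c d) 1) ∈
      Submodule.span K (Set.range (v K m)) := by
  by_cases h : 2 ≤ a ∨ 2 ≤ b ∨ 2 ≤ c ∨ m + 1 ≤ d ∨ (1 ≤ a ∧ 1 ≤ b) ∨ (1 ≤ a ∧ 1 ≤ c) ∨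
      (1 ≤ b ∧ m ≤ d) ∨ (1 ≤ c ∧ m ≤ d)
  · have := mk_zero K m a b c d h
    rw [mon_eq, Ideal.Quotient.eq_zero_iff_mem.2 this]
    exact zero_mem _
  · have hc : (a = 0 ∧ b = 0 ∧ c = 0 ∧ d < m + 1) ∨ (a = 1 ∧ b = 0 ∧ c = 0 ∧ d < m + 1) ∨
      (a = 0 ∧ b = 1 ∧ c = 0 ∧ d < m) ∨ (a = 0 ∧ b = 0 ∧ c = 1 ∧ d < m) ∨
      (a = 0 ∧ b = 1 ∧ c = 1 ∧ d < m) := by omega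
    rcases hc with ⟨rfl, rfl, rfl, hd⟩ | ⟨rfl, rfl, rfl, hd⟩ | ⟨rfl, rfl, rfl, hd⟩ |
      ⟨rfl, rfl, rfl, hd⟩ | ⟨rfl, rfl, rfl, hd⟩
    · exact Submodule.subset_span ⟨.inl (.inl ⟨d, hd⟩), rfl⟩
    · exact Submodule.subset_span ⟨.inl (.inr ⟨d, hd⟩), rfl⟩
    · exact Submodule.subset_span ⟨.inr (.inl ⟨d, hd⟩), rfl⟩
    · exact Submodule.subset_span ⟨.inr (.inr ⟨d, hd⟩), rfl⟩
    · rw [mk_bin]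
      exact Submodule.subset_span ⟨.inl (.inr ⟨d + 1, by omega⟩), rfl⟩

theorem sp (K : Type*) [Field K] (m : ℕ) : ⊤ ≤ Submodule.span K (Set.range (v K m)) := by
  rintro q -
  obtain ⟨p, rfl⟩ := Ideal.Quotient.mk_surjective q
  rw [p.as_sum, map_sum]
  refine Submodule.sum_mem _ fun s _ => ?_
  have e : (monomial s (coeff s p) : MvPolynomial (Fin 4) K)
      = coeff s p • monomial s (1 : K) := by
    rw [smul_monomial, smul_eq_mul, mul_one]
  have e2 : Ideal.Quotient.mk (relIdeal K m) (coeff s p • monomial s (1 : K))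
      = coeff s p • Ideal.Quotient.mk (relIdeal K m) (monomial s (1 : K)) := rfl
  rw [e, e2]
  refine Submodule.smul_mem _ _ ?_
  rw [exists_ex s]
  exact mon_mem K m _ _ _ _

end FPA

/-- The fundamental parallelepiped algebra of `Δ₂^m` is a finite-dimensional
`K`-vector space of dimension `4m + 2`. -/
theorem stmt0 (K : Type*) [Field K] [CharZero K] (m : ℕ) (hm : 1 ≤ m) :
    FiniteDimensional K (MvPolynomial (Fin 4) K ⧸ relIdeal K m) ∧
    Module.finrank K (MvPolynomial (Fin 4) K ⧸ relIdeal K m) = 4 * m + 2 := by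
  let b := Module.Basis.mk (FPA.li K m) (FPA.sp K m)
  refine ⟨b.finiteDimensional_of_finite, ?_⟩
  rw [Module.finrank_eq_card_basis b]
  simp
  omega
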